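/- arXiv:1501.07339 — 7 statements merged into one kernel-verified Lean document; each statement's English description precedes it below -/
import Mathlib

section
/- Suppose c₂ > 0, 2c₂ + c₄ > 0, and 3c₂ + 2c₃ + 2c₄ > 0. Then the minimum of f_s(Q, ν) over Q ∈ 𝒜 is attained, and it is attained exactly at the single matrix Q = (3λ/2)(ν⊗ν − (1/3)I), where λ = −c₁/(3c₂ + 2c₃ + 2c₄); in particular the minimizer is uniaxial with nematic director ν and Qν = λν. -/
open Matrix

/-- The surface energy `f_s(Q, ν) = c₁ (Qν·ν) + c₂ (Q·Q) + c₃ (Qν·ν)² + c₄ |Qν|²`,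
where `A·B = tr(BᵀA)`. -/
noncomputable def surfE (c₁ c₂ c₃ c₄ : ℝ) (Q : Matrix (Fin 3) (Fin 3) ℝ)
    (ν : Fin 3 → ℝ) : ℝ :=
  c₁ * (Q.mulVec ν ⬝ᵥ ν) + c₂ * (Qᵀ * Q).trace
    + c₃ * (Q.mulVec ν ⬝ᵥ ν) ^ 2 + c₄ * (Q.mulVec ν ⬝ᵥ Q.mulVec ν)

/-- The set `𝒜` of real symmetric traceless 3×3 matrices. -/
def inA (Q : Matrix (Fin 3) (Fin 3) ℝ) : Prop := Q.IsSymm ∧ Q.trace = 0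

theorem trace_transpose_mul_self_sub_symm_vecMulVec (D : Matrix (Fin 3) (Fin 3) ℝ)
    (hD : D.IsSymm) (t : ℝ) (u n : Fin 3 → ℝ) :
    ((D + t • 1 - (vecMulVec u n + vecMulVec n u))ᵀ *
        (D + t • 1 - (vecMulVec u n + vecMulVec n u))).trace =
      (Dᵀ * D).trace + 3 * t ^ 2 + 2 * t * D.trace + 2 * (u ⬝ᵥ u) * (n ⬝ᵥ n)
        + 2 * (u ⬝ᵥ n) ^ 2 - 4 * (D.mulVec n ⬝ᵥ u) - 4 * t * (u ⬝ᵥ n) := by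
  have h01 := hD.apply 0 1
  have h02 := hD.apply 0 2
  have h12 := hD.apply 1 2
  simp [Matrix.trace, Matrix.mul_apply, Fin.sum_univ_three, dotProduct, mulVec, vecMulVec_apply,
    h01, h02, h12]
  ring

theorem surfE_zero_nonneg_and_eq_zero {c₂ c₃ c₄ : ℝ} {ν : Fin 3 → ℝ} (hν : ν ⬝ᵥ ν = 1)
    (h2 : 0 < c₂) (h24 : 0 < 2 * c₂ + c₄) (h234 : 0 < 3 * c₂ + 2 * c₃ + 2 * c₄)
    {D : Matrix (Fin 3) (Fin 3) ℝ} (hD : inA D) :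
    0 ≤ surfE 0 c₂ c₃ c₄ D ν ∧ (surfE 0 c₂ c₃ c₄ D ν = 0 → D = 0) := by
  obtain ⟨hs, ht⟩ := hD
  obtain ⟨p, hp⟩ : ∃ p, p = D.mulVec ν := ⟨_, rfl⟩
  obtain ⟨d, hd⟩ : ∃ d, d = p ⬝ᵥ ν := ⟨_, rfl⟩
  obtain ⟨w, hw⟩ : ∃ w, w = p - d • ν := ⟨_, rfl⟩
  obtain ⟨u, hu⟩ : ∃ u, u = p - (d / 4) • ν := ⟨_, rfl⟩
  have key := trace_transpose_mul_self_sub_symm_vecMulVec D hs (d / 2) u ν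
  obtain ⟨E, hE⟩ : ∃ E, E = D + (d / 2) • 1 - (vecMulVec u ν + vecMulVec ν u) := ⟨_, rfl⟩
  rw [← hE, ht, hν, ← hp] at key
  have hww : w ⬝ᵥ w = p ⬝ᵥ p - d ^ 2 := by
    simp [hw, dotProduct_comm ν p, ← hd, hν]; ring
  have huu : u ⬝ᵥ u = p ⬝ᵥ p - 7 / 16 * d ^ 2 := by
    simp [hu, dotProduct_comm ν p, ← hd, hν]; ring
  have hun : u ⬝ᵥ ν = 3 / 4 * d := by
    simp [hu, ← hd, hν]; ring
  have hpu : p ⬝ᵥ u = p ⬝ᵥ p - d ^ 2 / 4 := by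
    simp [hu, ← hd]; ring
  rw [huu, hun, hpu] at key
  have hf : surfE 0 c₂ c₃ c₄ D ν = c₂ * (Eᵀ * E).trace + (2 * c₂ + c₄) * (w ⬝ᵥ w)
      + (3 * c₂ + 2 * c₃ + 2 * c₄) / 2 * d ^ 2 := by
    rw [surfE, ← hp, ← hd, hww, key]; ring
  have hE0 : 0 ≤ (Eᵀ * E).trace := by
    simpa using (posSemidef_conjTranspose_mul_self E).trace_nonneg
  have hw0 : 0 ≤ w ⬝ᵥ w := by simpa using dotProduct_star_self_nonneg w
  have a1 := mul_nonneg h2.le hE0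
  have a2 := mul_nonneg h24.le hw0
  have a3 := mul_nonneg (half_pos h234).le (sq_nonneg d)
  refine ⟨by rw [hf]; positivity, fun h => ?_⟩
  rw [hf] at h
  have e1 : (Eᵀ * E).trace = 0 :=
    (mul_eq_zero.mp (by linarith : c₂ * (Eᵀ * E).trace = 0)).resolve_left h2.ne'
  have e2 : w ⬝ᵥ w = 0 :=
    (mul_eq_zero.mp (by linarith : (2 * c₂ + c₄) * (w ⬝ᵥ w) = 0)).resolve_left h24.ne'
  have e3 : d = 0 := pow_eq_zero_iff two_ne_zero |>.mp <|
    (mul_eq_zero.mp (by linarith : (3 * c₂ + 2 * c₃ + 2 * c₄) / 2 * d ^ 2 = 0)).resolve_left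
      (half_pos h234).ne'
  have hp0 : p = 0 := by simpa [hw, e3] using dotProduct_self_eq_zero.mp e2
  have := trace_conjTranspose_mul_self_eq_zero_iff.mp
    ((congrArg (fun M => (M * E).trace) (conjTranspose_eq_transpose_of_trivial E)).trans e1)
  simpa [hE, hu, e3, hp0] using this

theorem surface_min_case_i (c₁ c₂ c₃ c₄ : ℝ) (ν : Fin 3 → ℝ) (hν : ν ⬝ᵥ ν = 1)
    (h2 : 0 < c₂) (h24 : 0 < 2 * c₂ + c₄) (h234 : 0 < 3 * c₂ + 2 * c₃ + 2 * c₄) :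
    ∀ lam Qmin : _, lam = -c₁ / (3 * c₂ + 2 * c₃ + 2 * c₄) →
      Qmin = (3 * lam / 2) •
        (vecMulVec ν ν - (1 / 3 : ℝ) • (1 : Matrix (Fin 3) (Fin 3) ℝ)) →
      inA Qmin ∧ Qmin.mulVec ν = lam • ν ∧
        (∀ Q, inA Q → surfE c₁ c₂ c₃ c₄ Qmin ν ≤ surfE c₁ c₂ c₃ c₄ Q ν) ∧
        (∀ Q, inA Q → surfE c₁ c₂ c₃ c₄ Q ν = surfE c₁ c₂ c₃ c₄ Qmin ν → Q = Qmin) := by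
  intro lam Qmin hlam hQ
  have hlam' : c₁ + (3 * c₂ + 2 * c₃ + 2 * c₄) * lam = 0 := by
    rw [hlam]; field_simp; ring
  have hsymm : Qmin.IsSymm := by
    rw [hQ, IsSymm]; simp [transpose_vecMulVec]
  have htr : Qmin.trace = 0 := by
    rw [hQ]; simp [trace_vecMulVec, hν]
  have hmul : Qmin.mulVec ν = lam • ν := by
    rw [hQ, smul_mulVec, sub_mulVec, vecMulVec_mulVec, hν, smul_mulVec, one_mulVec]
    ext i
    simp
    ring
  have hsplit : ∀ Q, inA Q → surfE c₁ c₂ c₃ c₄ Q ν =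
      surfE c₁ c₂ c₃ c₄ Qmin ν + surfE 0 c₂ c₃ c₄ (Q - Qmin) ν := by
    intro Q ⟨hs, ht⟩
    have hin : ∀ M : Matrix (Fin 3) (Fin 3) ℝ, M.trace = 0 →
        (Qmin * M).trace = 3 * lam / 2 * (M.mulVec ν ⬝ᵥ ν) := by
      intro M hM
      simp [hQ, sub_mul, vecMulVec_mul, trace_vecMulVec, hM, dotProduct_mulVec,
        dotProduct_comm _ ν]
    have h1 := hin Q ht
    have h2 := hin Qmin htr
    have h3 := trace_mul_comm Q Qmin
    simp only [surfE, transpose_sub, hs.eq, hsymm.eq, sub_mul, mul_sub, trace_sub, h3, h1, h2,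
      sub_mulVec, hmul, sub_dotProduct, dotProduct_sub, smul_dotProduct, dotProduct_smul, hν,
      dotProduct_comm ν, smul_eq_mul]
    linear_combination (Q.mulVec ν ⬝ᵥ ν - lam) * hlam'
  have hdiff : ∀ Q, inA Q → inA (Q - Qmin) := fun Q ⟨hs, ht⟩ =>
    ⟨hs.sub hsymm, by rw [trace_sub, ht, htr, sub_zero]⟩
  refine ⟨⟨hsymm, htr⟩, hmul, fun Q hA => ?_, fun Q hA h => ?_⟩
  · have := (surfE_zero_nonneg_and_eq_zero hν h2 h24 h234 (hdiff Q hA)).1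
    linarith [hsplit Q hA]
  · exact sub_eq_zero.mp <| (surfE_zero_nonneg_and_eq_zero hν h2 h24 h234 (hdiff Q hA)).2
      (by linarith [hsplit Q hA])
end

section
/- Suppose c₂ > 0, 2c₂ + c₄ > 0, 3c₂ + 2c₃ + 2c₄ = 0, and c₁ = 0. Then the minimum of f_s(Q, ν) over Q ∈ 𝒜 is attained, and the set of minimizers is exactly the set of matrices of the form Q = S(ν⊗ν − (1/3)I) for some S ∈ ℝ, i.e., the uniaxial matrices with nematic director parallel to ν (together with Q = 0). -/
open Matrix

/-- The tangential part `Qν - (Qν·ν)ν` of `Qν`. -/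
noncomputable def tangentialPart (Q : Matrix (Fin 3) (Fin 3) ℝ) (ν : Fin 3 → ℝ) : Fin 3 → ℝ :=
  Q *ᵥ ν - (Q *ᵥ ν ⬝ᵥ ν) • ν

/-- The part of `Q` left after removing its uniaxial component along `ν` and the mixed
tangential-normal component. -/
noncomputable def planarPart (Q : Matrix (Fin 3) (Fin 3) ℝ) (ν : Fin 3 → ℝ) :
    Matrix (Fin 3) (Fin 3) ℝ :=
  Q - (3 / 2 * (Q *ᵥ ν ⬝ᵥ ν)) • (vecMulVec ν ν - (1 / 3 : ℝ) • (1 : Matrix (Fin 3) (Fin 3) ℝ))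
    - vecMulVec (tangentialPart Q ν) ν - vecMulVec ν (tangentialPart Q ν)

theorem tangentialPart_dotProduct_self (Q : Matrix (Fin 3) (Fin 3) ℝ) {ν : Fin 3 → ℝ}
    (hν : ν ⬝ᵥ ν = 1) :
    tangentialPart Q ν ⬝ᵥ tangentialPart Q ν = Q *ᵥ ν ⬝ᵥ Q *ᵥ ν - (Q *ᵥ ν ⬝ᵥ ν) ^ 2 := by
  simp only [tangentialPart, sub_dotProduct, dotProduct_sub, smul_dotProduct, dotProduct_smul,
    smul_eq_mul, hν, dotProduct_comm ν (Q *ᵥ ν)]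
  ring

theorem trace_planarPart {Q : Matrix (Fin 3) (Fin 3) ℝ} (hQ : inA Q) {ν : Fin 3 → ℝ}
    (hν : ν ⬝ᵥ ν = 1) :
    ((planarPart Q ν)ᵀ * planarPart Q ν).trace =
      (Qᵀ * Q).trace - 2 * (Q *ᵥ ν ⬝ᵥ Q *ᵥ ν) + (Q *ᵥ ν ⬝ᵥ ν) ^ 2 / 2 := by
  obtain ⟨hs, ht⟩ := hQ
  have h01 := hs.apply 0 1
  have h02 := hs.apply 0 2
  have h12 := hs.apply 1 2
  have hu : ∀ i, Q i 0 * ν 0 + Q i 1 * ν 1 + Q i 2 * ν 2 = (Q *ᵥ ν) i := fun i => by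
    simp [mulVec, dotProduct, Fin.sum_univ_three]
  have hu0 := hu 0
  have hu1 := hu 1
  have hu2 := hu 2
  unfold planarPart tangentialPart
  generalize Q *ᵥ ν = u at *
  have ha : u 0 * ν 0 + u 1 * ν 1 + u 2 * ν 2 = u ⬝ᵥ ν := by
    simp [dotProduct, Fin.sum_univ_three]
  generalize u ⬝ᵥ ν = a at *
  simp [dotProduct, Matrix.trace, Matrix.mul_apply, Fin.sum_univ_three, vecMulVec_apply] at *
  rw [h01, h02] at *
  rw [h12] at *
  linear_combination (-4 * u 0 + a * ν 0) * hu0 + (-4 * u 1 + a * ν 1) * hu1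
    + (-4 * u 2 + a * ν 2) * hu2 + a * ht
    + (a ^ 2 / 4 * (ν 0 * ν 0 + ν 1 * ν 1 + ν 2 * ν 2 + 1)
      + 2 * (u 0 * u 0 + u 1 * u 1 + u 2 * u 2) + a ^ 2 / 2
      - 2 * a * (u 0 * ν 0 + u 1 * ν 1 + u 2 * ν 2)) * hν
    + (2 * (u 0 * ν 0 + u 1 * ν 1 + u 2 * ν 2 + a) - 3 * a) * ha

theorem surfE_eq_add {c₁ c₂ c₃ c₄ : ℝ} {ν : Fin 3 → ℝ} (hν : ν ⬝ᵥ ν = 1)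
    (h234 : 3 * c₂ + 2 * c₃ + 2 * c₄ = 0) (h1 : c₁ = 0) {Q : Matrix (Fin 3) (Fin 3) ℝ}
    (hQ : inA Q) :
    surfE c₁ c₂ c₃ c₄ Q ν = c₂ * ((planarPart Q ν)ᵀ * planarPart Q ν).trace
      + (2 * c₂ + c₄) * (tangentialPart Q ν ⬝ᵥ tangentialPart Q ν) := by
  rw [trace_planarPart hQ hν, tangentialPart_dotProduct_self Q hν, surfE, h1]
  linear_combination (Q *ᵥ ν ⬝ᵥ ν) ^ 2 / 2 * h234

theorem tangentialPart_uniaxial {ν : Fin 3 → ℝ} (hν : ν ⬝ᵥ ν = 1) (S : ℝ) :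
    tangentialPart (S • (vecMulVec ν ν - (1 / 3 : ℝ) • (1 : Matrix (Fin 3) (Fin 3) ℝ))) ν = 0 := by
  simp only [tangentialPart, smul_mulVec, sub_mulVec, vecMulVec_mulVec, one_mulVec, hν,
    sub_dotProduct, smul_dotProduct, smul_eq_mul]
  ext i
  simp
  ring

theorem planarPart_uniaxial {ν : Fin 3 → ℝ} (hν : ν ⬝ᵥ ν = 1) (S : ℝ) :
    planarPart (S • (vecMulVec ν ν - (1 / 3 : ℝ) • (1 : Matrix (Fin 3) (Fin 3) ℝ))) ν = 0 := by
  have ha : (S • (vecMulVec ν ν - (1 / 3 : ℝ) • (1 : Matrix (Fin 3) (Fin 3) ℝ))) *ᵥ ν ⬝ᵥ ν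
      = 2 / 3 * S := by
    simp [smul_mulVec, sub_mulVec, vecMulVec_mulVec, hν]
    ring
  rw [planarPart, tangentialPart_uniaxial hν, ha, show 3 / 2 * (2 / 3 * S) = S by ring]
  simp

theorem trace_transpose_mul_self_nonneg (A : Matrix (Fin 3) (Fin 3) ℝ) :
    0 ≤ (Aᵀ * A).trace := by
  simpa using (posSemidef_conjTranspose_mul_self A).trace_nonneg

theorem surface_min_case_ii (c₁ c₂ c₃ c₄ : ℝ) (ν : Fin 3 → ℝ) (hν : ν ⬝ᵥ ν = 1)
    (h2 : 0 < c₂) (h24 : 0 < 2 * c₂ + c₄)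
    (h234 : 3 * c₂ + 2 * c₃ + 2 * c₄ = 0) (h1 : c₁ = 0) :
    ∃ m : ℝ,
      (∃ Q₀, inA Q₀ ∧ surfE c₁ c₂ c₃ c₄ Q₀ ν = m) ∧
      (∀ Q, inA Q → m ≤ surfE c₁ c₂ c₃ c₄ Q ν) ∧
      (∀ Q, inA Q → (surfE c₁ c₂ c₃ c₄ Q ν = m ↔
        ∃ S : ℝ, Q = S • (vecMulVec ν ν - (1 / 3 : ℝ) • (1 : Matrix (Fin 3) (Fin 3) ℝ)))) := by
  have hw : ∀ Q, 0 ≤ tangentialPart Q ν ⬝ᵥ tangentialPart Q ν := fun Q =>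
    Finset.sum_nonneg fun i _ => mul_self_nonneg _
  refine ⟨0, ⟨0, ⟨by simp [Matrix.IsSymm], by simp⟩, by simp [surfE]⟩, fun Q hQ => ?_,
    fun Q hQ => ⟨fun h => ?_, ?_⟩⟩
  · rw [surfE_eq_add hν h234 h1 hQ]
    exact add_nonneg (mul_nonneg h2.le (trace_transpose_mul_self_nonneg _))
      (mul_nonneg h24.le (hw Q))
  · rw [surfE_eq_add hν h234 h1 hQ, add_eq_zero_iff_of_nonneg
      (mul_nonneg h2.le (trace_transpose_mul_self_nonneg _)) (mul_nonneg h24.le (hw Q))] at h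
    have hw0 : tangentialPart Q ν = 0 :=
      dotProduct_self_eq_zero.mp ((mul_eq_zero.mp h.2).resolve_left h24.ne')
    have hp0 : planarPart Q ν = 0 :=
      trace_conjTranspose_mul_self_eq_zero_iff.mp
        (by simpa using (mul_eq_zero.mp h.1).resolve_left h2.ne')
    refine ⟨3 / 2 * (Q *ᵥ ν ⬝ᵥ ν), ?_⟩
    rw [planarPart, hw0] at hp0
    simpa [sub_eq_zero] using hp0
  · rintro ⟨S, rfl⟩
    rw [surfE_eq_add hν h234 h1 hQ, planarPart_uniaxial hν, tangentialPart_uniaxial hν]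
    simp
end

section
/- Suppose c₂ = 0, c₄ > 0, and c₃ + c₄ > 0. Then the minimum of f_s(Q, ν) over Q ∈ 𝒜 is attained, and it is attained exactly at the matrices of the form Q = μ m⊗m + (c₁/(2(c₃+c₄)) − μ) n⊗n − (c₁/(2(c₃+c₄))) ν⊗ν, where {m, n} is an arbitrary orthonormal pair of vectors orthogonal to ν and μ ∈ ℝ is arbitrary. -/
open Matrix

lemma dotProduct_self_nonneg (v : Fin 3 → ℝ) : 0 ≤ v ⬝ᵥ v :=
  Finset.sum_nonneg fun i _ => mul_self_nonneg (v i)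

/-- A unit vector `(c, s)` rotating the quadratic form `[[p, q], [q, r]]` to diagonal form. -/
lemma exists_rotation_diagonalizing (p q r : ℝ) :
    ∃ c s : ℝ, c ^ 2 + s ^ 2 = 1 ∧ c * s * (r - p) + (c ^ 2 - s ^ 2) * q = 0 := by
  let z : ℂ := ⟨(p - r) / 2, q⟩
  refine ⟨Real.cos (z.arg / 2), Real.sin (z.arg / 2), Real.cos_sq_add_sin_sq _, ?_⟩
  have hre : ‖z‖ * Real.cos z.arg = (p - r) / 2 := Complex.norm_mul_cos_arg z
  have him : ‖z‖ * Real.sin z.arg = q := Complex.norm_mul_sin_arg z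
  have hc : Real.cos z.arg = Real.cos (z.arg / 2) ^ 2 - Real.sin (z.arg / 2) ^ 2 := by
    rw [← Real.cos_two_mul']; ring_nf
  have hs : Real.sin z.arg = 2 * Real.sin (z.arg / 2) * Real.cos (z.arg / 2) := by
    rw [← Real.sin_two_mul]; ring_nf
  linear_combination Real.sin z.arg * hre - Real.cos z.arg * him - q * hc + (p - r) / 2 * hs

/-- Resolution of the identity by an orthonormal basis of `ℝ³`. -/
lemma vecMulVec_add_vecMulVec_add_vecMulVec (m n ν : Fin 3 → ℝ)
    (hm : m ⬝ᵥ m = 1) (hn : n ⬝ᵥ n = 1) (hν : ν ⬝ᵥ ν = 1) (hmn : m ⬝ᵥ n = 0)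
    (hmν : m ⬝ᵥ ν = 0) (hnν : n ⬝ᵥ ν = 0) :
    vecMulVec m m + vecMulVec n n + vecMulVec ν ν = 1 := by
  have h : (of ![m, n, ν]) * (of ![m, n, ν])ᵀ = 1 := by
    ext i j
    change ![m, n, ν] i ⬝ᵥ ![m, n, ν] j = _
    fin_cases i <;> fin_cases j <;>
      simp [hm, hn, hν, hmn, hmν, hnν, dotProduct_comm n m, dotProduct_comm ν m,
        dotProduct_comm ν n]
  rw [← mul_eq_one_comm.1 h]
  ext i j
  simp [Matrix.mul_apply, Fin.sum_univ_three, vecMulVec_apply]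

/-- Every unit vector of `ℝ³` extends to an orthonormal basis. -/
lemma exists_orthonormal_pair (ν : Fin 3 → ℝ) (hν : ν ⬝ᵥ ν = 1) :
    ∃ a b : Fin 3 → ℝ, a ⬝ᵥ a = 1 ∧ b ⬝ᵥ b = 1 ∧ a ⬝ᵥ b = 0 ∧ a ⬝ᵥ ν = 0 ∧ b ⬝ᵥ ν = 0 := by
  obtain ⟨w, hw, hwν⟩ : ∃ w : Fin 3 → ℝ, w ≠ 0 ∧ w ⬝ᵥ ν = 0 := by
    by_cases h : ν 0 = 0
    · refine ⟨![1, 0, 0], fun h0 => ?_, by simp [dotProduct, Fin.sum_univ_three, h]⟩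
      simpa using congrFun h0 0
    · refine ⟨![ν 1, -ν 0, 0], fun h0 => h ?_, ?_⟩
      · simpa using congrFun h0 1
      · simp [dotProduct, Fin.sum_univ_three]; ring
  have hpos : 0 < w ⬝ᵥ w :=
    lt_of_le_of_ne (dotProduct_self_nonneg w)
      (fun h => hw (dotProduct_self_eq_zero.1 h.symm))
  obtain ⟨a, ha, haν⟩ : ∃ a : Fin 3 → ℝ, a ⬝ᵥ a = 1 ∧ a ⬝ᵥ ν = 0 := by
    refine ⟨(√(w ⬝ᵥ w))⁻¹ • w, ?_, by simp [hwν]⟩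
    have h1 := Real.sq_sqrt hpos.le
    have h2 := (Real.sqrt_pos.2 hpos).ne'
    rw [smul_dotProduct, dotProduct_smul, smul_eq_mul, smul_eq_mul]
    field_simp
    exact h1.symm
  refine ⟨a, crossProduct a ν, ha, ?_, dot_self_cross a ν, haν, ?_⟩
  · rw [cross_dot_cross, ha, hν, haν]; simp
  · rw [dotProduct_comm]; exact dot_cross_self a ν

/-- Expansion of a matrix along an orthonormal basis that diagonalizes it. -/
lemma eq_sum_vecMulVec (Q : Matrix (Fin 3) (Fin 3) ℝ) (α β γ : ℝ) (m n ν : Fin 3 → ℝ)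
    (hm : m ⬝ᵥ m = 1) (hn : n ⬝ᵥ n = 1) (hν : ν ⬝ᵥ ν = 1) (hmn : m ⬝ᵥ n = 0)
    (hmν : m ⬝ᵥ ν = 0) (hnν : n ⬝ᵥ ν = 0)
    (h1 : Q *ᵥ m = α • m) (h2 : Q *ᵥ n = β • n) (h3 : Q *ᵥ ν = γ • ν) :
    Q = α • vecMulVec m m + β • vecMulVec n n + γ • vecMulVec ν ν := by
  have key := vecMulVec_add_vecMulVec_add_vecMulVec m n ν hm hn hν hmn hmν hnν
  calc Q = Q * (vecMulVec m m + vecMulVec n n + vecMulVec ν ν) := by rw [key, mul_one]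
    _ = _ := by
      simp only [mul_add, mul_vecMulVec, h1, h2, h3, smul_vecMulVec]

/-- A symmetric matrix with eigenvector `ν` is diagonal in an orthonormal basis containing `ν`. -/
lemma exists_eigenbasis (Q : Matrix (Fin 3) (Fin 3) ℝ) (hQ : Q.IsSymm) (γ : ℝ)
    (ν : Fin 3 → ℝ) (hν : ν ⬝ᵥ ν = 1) (hQν : Q *ᵥ ν = γ • ν) :
    ∃ (α β : ℝ) (m n : Fin 3 → ℝ), m ⬝ᵥ m = 1 ∧ n ⬝ᵥ n = 1 ∧ m ⬝ᵥ n = 0 ∧ m ⬝ᵥ ν = 0 ∧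
      n ⬝ᵥ ν = 0 ∧ Q = α • vecMulVec m m + β • vecMulVec n n + γ • vecMulVec ν ν := by
  have hsymm : ∀ x y, x ⬝ᵥ Q *ᵥ y = y ⬝ᵥ Q *ᵥ x := fun x y => by
    rw [dotProduct_mulVec, ← mulVec_transpose, hQ.eq, dotProduct_comm]
  have hνQ : ∀ x, x ⬝ᵥ ν = 0 → ν ⬝ᵥ Q *ᵥ x = 0 := fun x hx => by
    rw [hsymm, hQν, dotProduct_smul, hx, smul_zero]
  obtain ⟨m, n, hm, hn, hmn, hmν, hnν, h⟩ : ∃ m n : Fin 3 → ℝ, m ⬝ᵥ m = 1 ∧ n ⬝ᵥ n = 1 ∧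
      m ⬝ᵥ n = 0 ∧ m ⬝ᵥ ν = 0 ∧ n ⬝ᵥ ν = 0 ∧ m ⬝ᵥ Q *ᵥ n = 0 := by
    obtain ⟨a, b, ha, hb, hab, haν, hbν⟩ := exists_orthonormal_pair ν hν
    have hba : b ⬝ᵥ a = 0 := by rw [dotProduct_comm, hab]
    obtain ⟨c, s, hcs, h0⟩ := exists_rotation_diagonalizing
      (a ⬝ᵥ Q *ᵥ a) (a ⬝ᵥ Q *ᵥ b) (b ⬝ᵥ Q *ᵥ b)
    refine ⟨c • a + s • b, -s • a + c • b, ?_, ?_, ?_, ?_, ?_, ?_⟩ <;>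
      simp only [mulVec_add, mulVec_smul, add_dotProduct, dotProduct_add, smul_dotProduct,
        dotProduct_smul, smul_eq_mul, ha, hb, hab, hba, haν, hbν, hsymm b a]
    · linear_combination hcs
    · linear_combination hcs
    · ring
    · ring
    · ring
    · linear_combination h0
  have expand : ∀ x, x = (m ⬝ᵥ x) • m + (n ⬝ᵥ x) • n + (ν ⬝ᵥ x) • ν := fun x => by
    have := congrArg (· *ᵥ x)
      (vecMulVec_add_vecMulVec_add_vecMulVec m n ν hm hn hν hmn hmν hnν)
    simpa [add_mulVec, vecMulVec_mulVec] using this.symm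
  refine ⟨m ⬝ᵥ Q *ᵥ m, n ⬝ᵥ Q *ᵥ n, m, n, hm, hn, hmn, hmν, hnν,
    eq_sum_vecMulVec Q _ _ _ m n ν hm hn hν hmn hmν hnν ?_ ?_ hQν⟩
  · have := expand (Q *ᵥ m)
    rwa [hsymm n m, h, hνQ m hmν, zero_smul, zero_smul, add_zero, add_zero] at this
  · have := expand (Q *ᵥ n)
    rwa [h, hνQ n hnν, zero_smul, zero_smul, zero_add, add_zero] at this

lemma surfE_eq (k c₃ c₄ : ℝ) (Q : Matrix (Fin 3) (Fin 3) ℝ) (ν : Fin 3 → ℝ)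
    (hν : ν ⬝ᵥ ν = 1) :
    surfE (2 * (c₃ + c₄) * k) 0 c₃ c₄ Q ν = -(c₃ + c₄) * k ^ 2
      + (c₃ + c₄) * (Q *ᵥ ν ⬝ᵥ ν + k) ^ 2
      + c₄ * ((Q *ᵥ ν - (Q *ᵥ ν ⬝ᵥ ν) • ν) ⬝ᵥ (Q *ᵥ ν - (Q *ᵥ ν ⬝ᵥ ν) • ν)) := by
  simp only [surfE, sub_dotProduct, dotProduct_sub, smul_dotProduct, dotProduct_smul, smul_eq_mul,
    hν, dotProduct_comm ν (Q *ᵥ ν)]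
  ring

lemma le_surfE (k c₃ c₄ : ℝ) (h4 : 0 < c₄) (h34 : 0 < c₃ + c₄)
    (Q : Matrix (Fin 3) (Fin 3) ℝ) (ν : Fin 3 → ℝ) (hν : ν ⬝ᵥ ν = 1) :
    -(c₃ + c₄) * k ^ 2 ≤ surfE (2 * (c₃ + c₄) * k) 0 c₃ c₄ Q ν := by
  rw [surfE_eq k c₃ c₄ Q ν hν]
  have h1 := mul_nonneg h34.le (sq_nonneg (Q *ᵥ ν ⬝ᵥ ν + k))
  have h2 := mul_nonneg h4.le (dotProduct_self_nonneg (Q *ᵥ ν - (Q *ᵥ ν ⬝ᵥ ν) • ν))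
  linarith

lemma surfE_le_iff (k c₃ c₄ : ℝ) (h4 : 0 < c₄) (h34 : 0 < c₃ + c₄)
    (Q : Matrix (Fin 3) (Fin 3) ℝ) (ν : Fin 3 → ℝ) (hν : ν ⬝ᵥ ν = 1) :
    surfE (2 * (c₃ + c₄) * k) 0 c₃ c₄ Q ν ≤ -(c₃ + c₄) * k ^ 2 ↔ Q *ᵥ ν = (-k) • ν := by
  rw [surfE_eq k c₃ c₄ Q ν hν]
  constructor
  · intro h
    have h1 := mul_nonneg h34.le (sq_nonneg (Q *ᵥ ν ⬝ᵥ ν + k))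
    have h2 := mul_nonneg h4.le (dotProduct_self_nonneg (Q *ᵥ ν - (Q *ᵥ ν ⬝ᵥ ν) • ν))
    have h3 : (Q *ᵥ ν ⬝ᵥ ν + k) ^ 2 = 0 :=
      (mul_eq_zero.1 (by linarith : (c₃ + c₄) * (Q *ᵥ ν ⬝ᵥ ν + k) ^ 2 = 0)).resolve_left h34.ne'
    have h5 := (mul_eq_zero.1 (le_antisymm (by linarith) h2)).resolve_left h4.ne'
    have h6 : Q *ᵥ ν ⬝ᵥ ν = -k := by linarith [pow_eq_zero_iff two_ne_zero |>.1 h3]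
    rw [← h6]
    exact sub_eq_zero.1 (dotProduct_self_eq_zero.1 h5)
  · intro h
    simp [h, hν]

lemma trace_smul_vecMulVec_add (α β γ : ℝ) (m n ν : Fin 3 → ℝ)
    (hm : m ⬝ᵥ m = 1) (hn : n ⬝ᵥ n = 1) (hν : ν ⬝ᵥ ν = 1) :
    (α • vecMulVec m m + β • vecMulVec n n + γ • vecMulVec ν ν).trace = α + β + γ := by
  simp [trace_vecMulVec, hm, hn, hν]

theorem surface_min_case_iv (c₁ c₂ c₃ c₄ : ℝ) (ν : Fin 3 → ℝ) (hν : ν ⬝ᵥ ν = 1)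
    (h2 : c₂ = 0) (h4 : 0 < c₄) (h34 : 0 < c₃ + c₄) :
    (∃ Q₀, inA Q₀ ∧ ∀ Q, inA Q → surfE c₁ c₂ c₃ c₄ Q₀ ν ≤ surfE c₁ c₂ c₃ c₄ Q ν) ∧
    (∀ Q, inA Q →
      ((∀ Q', inA Q' → surfE c₁ c₂ c₃ c₄ Q ν ≤ surfE c₁ c₂ c₃ c₄ Q' ν) ↔
        ∃ (μ : ℝ) (m n : Fin 3 → ℝ),
          m ⬝ᵥ m = 1 ∧ n ⬝ᵥ n = 1 ∧ m ⬝ᵥ n = 0 ∧ m ⬝ᵥ ν = 0 ∧ n ⬝ᵥ ν = 0 ∧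
          Q = μ • vecMulVec m m + (c₁ / (2 * (c₃ + c₄)) - μ) • vecMulVec n n
              - (c₁ / (2 * (c₃ + c₄))) • vecMulVec ν ν)) := by
  subst h2
  obtain ⟨k, hk⟩ : ∃ k, c₁ / (2 * (c₃ + c₄)) = k := ⟨_, rfl⟩
  obtain rfl : c₁ = 2 * (c₃ + c₄) * k := by rw [← hk]; field_simp
  rw [hk]
  have hform : ∀ (μ : ℝ) (m n : Fin 3 → ℝ), μ • vecMulVec m m + (k - μ) • vecMulVec n n
      - k • vecMulVec ν ν = μ • vecMulVec m m + (k - μ) • vecMulVec n n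
      + (-k) • vecMulVec ν ν := fun μ m n => by rw [neg_smul, sub_eq_add_neg]
  simp only [hform]
  have heig : ∀ (μ : ℝ) (m n : Fin 3 → ℝ), m ⬝ᵥ ν = 0 → n ⬝ᵥ ν = 0 →
      (μ • vecMulVec m m + (k - μ) • vecMulVec n n + (-k) • vecMulVec ν ν) *ᵥ ν = (-k) • ν := by
    intro μ m n hm hn
    simp [add_mulVec, neg_mulVec, smul_mulVec, vecMulVec_mulVec, hm, hn, hν]
  have hmin : ∀ Q : Matrix (Fin 3) (Fin 3) ℝ, Q *ᵥ ν = (-k) • ν → ∀ Q',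
      surfE (2 * (c₃ + c₄) * k) 0 c₃ c₄ Q ν ≤ surfE (2 * (c₃ + c₄) * k) 0 c₃ c₄ Q' ν :=
    fun Q hQ Q' => ((surfE_le_iff k c₃ c₄ h4 h34 Q ν hν).2 hQ).trans
      (le_surfE k c₃ c₄ h4 h34 Q' ν hν)
  obtain ⟨Q₀, hA, hQ₀⟩ : ∃ Q₀, inA Q₀ ∧ Q₀ *ᵥ ν = (-k) • ν := by
    obtain ⟨a, b, ha, hb, -, haν, hbν⟩ := exists_orthonormal_pair ν hν
    refine ⟨_, ⟨?_, ?_⟩, heig 0 a b haν hbν⟩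
    · simp [IsSymm, transpose_vecMulVec]
    · rw [trace_smul_vecMulVec_add _ _ _ a b ν ha hb hν]; ring
  refine ⟨⟨Q₀, hA, fun Q _ => hmin Q₀ hQ₀ Q⟩, fun Q hQ => ⟨fun h => ?_, ?_⟩⟩
  · have hQν := (surfE_le_iff k c₃ c₄ h4 h34 Q ν hν).1
      ((h Q₀ hA).trans ((surfE_le_iff k c₃ c₄ h4 h34 Q₀ ν hν).2 hQ₀))
    obtain ⟨α, β, m, n, hm, hn, hmn, hmν, hnν, hQeq⟩ := exists_eigenbasis Q hQ.1 (-k) ν hν hQν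
    have htr := hQ.2
    rw [hQeq, trace_smul_vecMulVec_add _ _ _ m n ν hm hn hν] at htr
    obtain rfl : β = k - α := by linarith
    exact ⟨α, m, n, hm, hn, hmn, hmν, hnν, hQeq⟩
  · rintro ⟨μ, m, n, -, -, -, hmν, hnν, rfl⟩ Q' -
    exact hmin _ (heig μ m n hmν hnν) Q'
end

section
/- If c₂ > 0 and min{3c₂ + 2c₃ + 2c₄, 2c₂ + c₄} < 0, then the infimum of f_s(Q, ν) over Q ∈ 𝒜 equals −∞. -/
open Matrix

lemma exists_mul_add_mul_sq_lt (a : ℝ) {b : ℝ} (hb : b < 0) (M : ℝ) :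
    ∃ t : ℝ, a * t + b * t ^ 2 < M := by
  have hk : 0 < -b := neg_pos.mpr hb
  set t := (|a| + 1) / -b + |M| + 1 with ht
  have hq : 0 < (|a| + 1) / -b := by positivity
  have htM : |M| < t := by linarith
  have ht0 : 0 < t := (abs_nonneg M).trans_lt htM
  have hbt : |a| + 1 ≤ t * -b := (div_le_iff₀ hk).mp (by linarith [abs_nonneg M])
  have hfac : a + b * t ≤ -1 := by linarith [le_abs_self a]
  refine ⟨t, ?_⟩
  nlinarith [neg_abs_le M]

lemma exists_orthogonal_ne_zero (ν : Fin 3 → ℝ) : ∃ m : Fin 3 → ℝ, m ⬝ᵥ ν = 0 ∧ m ≠ 0 := by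
  by_cases h : ν 0 = 0
  · exact ⟨![1, 0, 0], by simp [dotProduct, Fin.sum_univ_three, h], fun h0 => by
      simpa using congrFun h0 0⟩
  · refine ⟨![ν 1, -ν 0, 0], ?_, fun h0 => h (by simpa using congrFun h0 1)⟩
    simp [dotProduct, Fin.sum_univ_three]
    ring

lemma inA_uniaxial {ν : Fin 3 → ℝ} (hν : ν ⬝ᵥ ν = 1) (t : ℝ) :
    inA (t • (vecMulVec ν ν - (1 / 3 : ℝ) • 1)) := by
  refine ⟨?_, ?_⟩
  · simp [IsSymm, transpose_vecMulVec]
  · simp [trace_vecMulVec, hν]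

lemma surfE_uniaxial (c₁ c₂ c₃ c₄ : ℝ) {ν : Fin 3 → ℝ} (hν : ν ⬝ᵥ ν = 1) (t : ℝ) :
    surfE c₁ c₂ c₃ c₄ (t • (vecMulVec ν ν - (1 / 3 : ℝ) • 1)) ν =
      2 / 3 * c₁ * t + 2 / 9 * (3 * c₂ + 2 * c₃ + 2 * c₄) * t ^ 2 := by
  have hmul : (t • (vecMulVec ν ν - (1 / 3 : ℝ) • 1)) *ᵥ ν = (2 / 3 * t) • ν := by
    ext i
    simp [smul_mulVec, sub_mulVec, vecMulVec_mulVec, hν]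
    ring
  rw [surfE, hmul, (inA_uniaxial hν t).1.eq]
  simp [mul_sub, sub_mul, vecMulVec_mul_vecMulVec, trace_vecMulVec, hν]
  ring

lemma inA_biaxial {ν m : Fin 3 → ℝ} (hm : m ⬝ᵥ ν = 0) (t : ℝ) :
    inA (t • (vecMulVec ν m + vecMulVec m ν)) := by
  refine ⟨?_, ?_⟩
  · simp [IsSymm, transpose_vecMulVec, add_comm]
  · simp [trace_vecMulVec, hm, dotProduct_comm ν m]

lemma surfE_biaxial (c₁ c₂ c₃ c₄ : ℝ) {ν m : Fin 3 → ℝ} (hν : ν ⬝ᵥ ν = 1)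
    (hm : m ⬝ᵥ ν = 0) (t : ℝ) :
    surfE c₁ c₂ c₃ c₄ (t • (vecMulVec ν m + vecMulVec m ν)) ν =
      (2 * c₂ + c₄) * (m ⬝ᵥ m) * t ^ 2 := by
  have hmul : (t • (vecMulVec ν m + vecMulVec m ν)) *ᵥ ν = t • m := by
    simp [smul_mulVec, add_mulVec, vecMulVec_mulVec, hν, hm]
  rw [surfE, hmul, (inA_biaxial hm t).1.eq]
  simp [mul_add, add_mul, vecMulVec_mul_vecMulVec, trace_vecMulVec, hν, hm,
    dotProduct_comm ν m]
  ring

theorem surface_unbounded_mixed (c₁ c₂ c₃ c₄ : ℝ) (ν : Fin 3 → ℝ) (hν : ν ⬝ᵥ ν = 1)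
    (h2 : 0 < c₂) (hmin : min (3 * c₂ + 2 * c₃ + 2 * c₄) (2 * c₂ + c₄) < 0) :
    ∀ M : ℝ, ∃ Q, inA Q ∧ surfE c₁ c₂ c₃ c₄ Q ν < M := by
  intro M
  rcases min_lt_iff.mp hmin with h | h
  · obtain ⟨t, ht⟩ := exists_mul_add_mul_sq_lt (2 / 3 * c₁)
      (mul_neg_of_pos_of_neg (by norm_num : (0 : ℝ) < 2 / 9) h) M
    exact ⟨_, inA_uniaxial hν t, (surfE_uniaxial c₁ c₂ c₃ c₄ hν t).trans_lt ht⟩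
  · obtain ⟨m, hm, hm0⟩ := exists_orthogonal_ne_zero ν
    have hpos : 0 < m ⬝ᵥ m := by simpa using dotProduct_star_self_pos_iff.mpr hm0
    obtain ⟨t, ht⟩ := exists_mul_add_mul_sq_lt 0 (mul_neg_of_neg_of_pos h hpos) M
    rw [zero_mul, zero_add] at ht
    exact ⟨_, inA_biaxial hm t, (surfE_biaxial c₁ c₂ c₃ c₄ hν hm t).trans_lt ht⟩
end

section
/- Suppose c₂ = 0, c₄ > 0, and c₃ + c₄ > 0, and let {m, n, ν} be an orthonormal basis of ℝ³. Then for every μ ∈ ℝ, the matrix Q = μ m⊗m + (c₁/(2(c₃+c₄)) − μ) n⊗n − (c₁/(2(c₃+c₄))) ν⊗ν belongs to 𝒜, satisfies Qν = −(c₁/(2(c₃+c₄))) ν, and f_s(Q, ν) = −c₁²/(4(c₃ + c₄)), which is the infimum of f_s(·, ν) over 𝒜. -/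
open Matrix

lemma sq_dotProduct_le_of_dotProduct_self_eq_one {ι : Type*} [Fintype ι] (v ν : ι → ℝ)
    (hν : ν ⬝ᵥ ν = 1) : (v ⬝ᵥ ν) ^ 2 ≤ v ⬝ᵥ v := by
  have h : 0 ≤ (v - (v ⬝ᵥ ν) • ν) ⬝ᵥ (v - (v ⬝ᵥ ν) • ν) :=
    Finset.sum_nonneg fun i _ => mul_self_nonneg _
  simp only [sub_dotProduct, dotProduct_sub, smul_dotProduct, dotProduct_smul, smul_eq_mul,
    hν, dotProduct_comm ν v] at h
  linarith

lemma neg_sq_div_le_quadratic (b x : ℝ) {a : ℝ} (ha : 0 < a) :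
    -b ^ 2 / (4 * a) ≤ b * x + a * x ^ 2 := by
  rw [div_le_iff₀ (by positivity)]
  nlinarith [sq_nonneg (2 * a * x + b)]

theorem case_iv_minimizers (c₁ c₂ c₃ c₄ : ℝ) (h2 : c₂ = 0) (h4 : 0 < c₄)
    (h34 : 0 < c₃ + c₄) (m n ν : Fin 3 → ℝ)
    (hm : m ⬝ᵥ m = 1) (hn : n ⬝ᵥ n = 1) (hν : ν ⬝ᵥ ν = 1)
    (hmn : m ⬝ᵥ n = 0) (hmν : m ⬝ᵥ ν = 0) (hnν : n ⬝ᵥ ν = 0) :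
    ∀ μ : ℝ, ∀ Q : Matrix (Fin 3) (Fin 3) ℝ,
      Q = μ • vecMulVec m m + (c₁ / (2 * (c₃ + c₄)) - μ) • vecMulVec n n
          - (c₁ / (2 * (c₃ + c₄))) • vecMulVec ν ν →
      inA Q ∧ Q.mulVec ν = (-(c₁ / (2 * (c₃ + c₄)))) • ν ∧
        surfE c₁ c₂ c₃ c₄ Q ν = -c₁ ^ 2 / (4 * (c₃ + c₄)) ∧
        (∀ Q', inA Q' → -c₁ ^ 2 / (4 * (c₃ + c₄)) ≤ surfE c₁ c₂ c₃ c₄ Q' ν) := by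
  intro μ Q hQ
  have hQν : Q.mulVec ν = (-(c₁ / (2 * (c₃ + c₄)))) • ν := by
    simp [hQ, sub_mulVec, add_mulVec, smul_mulVec, vecMulVec_mulVec, hmν, hnν, hν]
  refine ⟨⟨?_, ?_⟩, hQν, ?_, fun Q' _ => ?_⟩
  · simp [hQ, Matrix.IsSymm, transpose_vecMulVec]
  · simp [hQ, trace_vecMulVec, hm, hn, hν]
  · simp only [surfE, hQν, h2, smul_dotProduct, dotProduct_smul, smul_eq_mul, hν]
    field_simp
    ring
  · have hCS := sq_dotProduct_le_of_dotProduct_self_eq_one (Q'.mulVec ν) ν hν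
    have hmin := neg_sq_div_le_quadratic c₁ (Q'.mulVec ν ⬝ᵥ ν) h34
    have hmul := mul_le_mul_of_nonneg_left hCS h4.le
    simp only [surfE, h2]
    linarith
end

section
/- Let Q be a nonzero real symmetric traceless 3×3 matrix and define the biaxiality measure ξ(Q)² := 1 − 6 (tr(Q³))²/(tr(Q²))³. If ξ(Q)² = 0, then Q is uniaxial, i.e., Q has a repeated eigenvalue, so that Q = S(n⊗n − (1/3)I) for some S ≠ 0 and some unit vector n ∈ ℝ³. -/
open Matrix

/-- A real symmetric matrix is orthogonally diagonalizable. -/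
lemma exists_orthogonal_diagonalization {n : Type*} [Fintype n] [DecidableEq n]
    {Q : Matrix n n ℝ} (hQ : Q.IsSymm) :
    ∃ (U : Matrix n n ℝ) (d : n → ℝ), U * Uᵀ = 1 ∧ Uᵀ * U = 1 ∧ Q = U * diagonal d * Uᵀ := by
  have hH : Q.IsHermitian := by
    rw [Matrix.IsHermitian, conjTranspose_eq_transpose_of_trivial]
    exact hQ
  refine ⟨hH.eigenvectorUnitary, hH.eigenvalues, ?_, ?_, ?_⟩
  · simpa [star_eq_conjTranspose] using Unitary.coe_mul_star_self hH.eigenvectorUnitary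
  · simpa [star_eq_conjTranspose] using Unitary.coe_star_mul_self hH.eigenvectorUnitary
  · have h := hH.spectral_theorem
    rw [Unitary.conjStarAlgAut_apply] at h
    simpa [star_eq_conjTranspose, Function.comp_def] using h

/-- The trace of a power of an orthogonally diagonalized matrix is the power sum of the
diagonal entries. -/
lemma trace_pow_orthogonal_conj_diagonal {n : Type*} [Fintype n] [DecidableEq n]
    {U : Matrix n n ℝ} (hU : Uᵀ * U = 1) (d : n → ℝ) (k : ℕ) :
    ((U * diagonal d * Uᵀ) ^ k).trace = ∑ i, d i ^ k := by
  have hpow : (U * diagonal d * Uᵀ) ^ k = U * diagonal d ^ k * Uᵀ := by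
    induction k with
    | zero => simpa using (mul_eq_one_comm.mp hU).symm
    | succ k ih =>
      rw [pow_succ, ih, pow_succ]
      calc U * diagonal d ^ k * Uᵀ * (U * diagonal d * Uᵀ)
          = U * diagonal d ^ k * (Uᵀ * U) * diagonal d * Uᵀ := by simp only [Matrix.mul_assoc]
        _ = U * (diagonal d ^ k * diagonal d) * Uᵀ := by
          rw [hU, Matrix.mul_one]; simp only [Matrix.mul_assoc]
  rw [hpow, trace_mul_comm, ← Matrix.mul_assoc, hU, Matrix.one_mul, diagonal_pow, trace_diagonal]
  simp

/-- If all diagonal entries except the `i`-th agree, the matrix is a rank-one perturbation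
of a scalar matrix. -/
lemma orthogonal_conj_diagonal_eq_smul_one_add {n : Type*} [Fintype n] [DecidableEq n]
    {U : Matrix n n ℝ} (hU : U * Uᵀ = 1) {d : n → ℝ} {a : ℝ} {i : n}
    (hd : ∀ j, j ≠ i → d j = a) :
    U * diagonal d * Uᵀ = a • 1 + (d i - a) • vecMulVec (Uᵀ i) (Uᵀ i) := by
  rw [← hU]
  ext r s
  have h : ∀ j, U r j * d j * U s j =
      a * (U r j * U s j) + if j = i then (d i - a) * (U r i * U s i) else 0 := by
    intro j
    by_cases hj : j = i
    · subst hj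
      rw [if_pos rfl]
      ring
    · rw [if_neg hj, hd j hj]
      ring
  rw [Matrix.mul_apply]
  simp only [mul_diagonal, transpose_apply, h]
  simp [Matrix.mul_apply, vecMulVec_apply, Finset.sum_add_distrib, Finset.mul_sum]

/-- Three reals with zero sum and vanishing discriminant: all but one of them agree. -/
lemma exists_forall_ne_eq_of_sum_eq_zero {d : Fin 3 → ℝ} (h1 : ∑ i, d i = 0)
    (h : (∑ i, d i ^ 2) ^ 3 = 6 * (∑ i, d i ^ 3) ^ 2) :
    ∃ (i : Fin 3) (a : ℝ), d i = -2 * a ∧ ∀ j, j ≠ i → d j = a := by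
  simp only [Fin.sum_univ_three] at h1 h
  have hc : d 2 = -d 0 - d 1 := by linarith
  have hdisc : ((d 0 - d 1) * (d 1 - d 2) * (d 2 - d 0)) ^ 2 = 0 := by
    rw [hc] at h ⊢
    linear_combination h / 2
  rcases mul_eq_zero.mp (pow_eq_zero_iff two_ne_zero |>.mp hdisc) with h' | h'
  · rcases mul_eq_zero.mp h' with h' | h'
    · refine ⟨2, d 0, by linarith, fun j hj => ?_⟩
      fin_cases j <;> simp at hj ⊢ <;> linarith
    · refine ⟨0, d 1, by linarith, fun j hj => ?_⟩
      fin_cases j <;> simp at hj ⊢ <;> linarith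
  · refine ⟨1, d 0, by linarith, fun j hj => ?_⟩
    fin_cases j <;> simp at hj ⊢ <;> linarith

/-- If a nonzero symmetric traceless 3×3 matrix `Q` has vanishing biaxiality measure
`ξ(Q)² = 1 − 6 (tr Q³)²/(tr Q²)³ = 0`, then `Q` is uniaxial:
`Q = S(n⊗n − (1/3)I)` for some `S ≠ 0` and unit vector `n`. -/
theorem biaxiality_zero_implies_uniaxial (Q : Matrix (Fin 3) (Fin 3) ℝ)
    (hsymm : Q.IsSymm) (htr : Q.trace = 0) (hne : Q ≠ 0)
    (hξ : 1 - 6 * ((Q ^ 3).trace) ^ 2 / ((Q ^ 2).trace) ^ 3 = 0) :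
    ∃ (S : ℝ) (n : Fin 3 → ℝ), S ≠ 0 ∧ n ⬝ᵥ n = 1 ∧
      Q = S • (vecMulVec n n - (1 / 3 : ℝ) • (1 : Matrix (Fin 3) (Fin 3) ℝ)) := by
  have hratio : (Q ^ 2).trace ^ 3 = 6 * (Q ^ 3).trace ^ 2 := by
    have hp : (Q ^ 2).trace ^ 3 ≠ 0 := by
      intro h0
      simp [h0] at hξ
    exact ((div_eq_one_iff_eq hp).mp (sub_eq_zero.mp hξ).symm).symm
  obtain ⟨U, d, hU, hU', rfl⟩ := exists_orthogonal_diagonalization hsymm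
  have h1 := trace_pow_orthogonal_conj_diagonal hU' d 1
  simp only [pow_one] at h1
  rw [h1] at htr
  rw [trace_pow_orthogonal_conj_diagonal hU', trace_pow_orthogonal_conj_diagonal hU'] at hratio
  obtain ⟨i, a, hi, hd⟩ := exists_forall_ne_eq_of_sum_eq_zero htr hratio
  have hQ := orthogonal_conj_diagonal_eq_smul_one_add hU hd
  refine ⟨-3 * a, Uᵀ i, ?_, ?_, ?_⟩
  · intro h0
    have ha : a = 0 := by linarith
    exact hne (by rw [hQ, hi, ha]; simp)
  · simpa [Matrix.mul_apply, dotProduct] using congrFun (congrFun hU' i) i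
  · rw [hQ, hi]
    module
end

section
/- Let β ≠ 0 and let ẑ = (0,0,1). Suppose Q is a real symmetric traceless 3×3 matrix with Qẑ = βẑ which is uniaxial, i.e., Q = S(n⊗n − (1/3)I) for some S ≠ 0 and unit vector n ∈ ℝ³. Then exactly one of the following holds: (a) Q = (3β/2)(ẑ⊗ẑ − (1/3)I) (director parallel to ẑ), or (b) Q = −3β(m⊗m − (1/3)I) for some unit vector m ∈ ℝ³ orthogonal to ẑ (director in the plane of the film). -/
open Matrix

/-- Let `β ≠ 0`, `zhat = (0,0,1)`. If `Q` is symmetric, traceless, uniaxial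
(`Q = S(n⊗n − (1/3)I)`, `S ≠ 0`, `|n| = 1`) and `Q zhat = β zhat`, then exactly one of:
(a) `Q = (3β/2)(zhat⊗zhat − (1/3)I)`, or (b) `Q = −3β(m⊗m − (1/3)I)` for some unit
vector `m` orthogonal to `zhat`. -/
theorem uniaxial_with_z_eigenvector (β : ℝ) (hβ : β ≠ 0)
    (Q : Matrix (Fin 3) (Fin 3) ℝ) (hsymm : Q.IsSymm) (htr : Q.trace = 0)
    (zhat : Fin 3 → ℝ) (hz : zhat = ![0, 0, 1]) (heig : Q.mulVec zhat = β • zhat)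
    (huni : ∃ (S : ℝ) (n : Fin 3 → ℝ), S ≠ 0 ∧ n ⬝ᵥ n = 1 ∧
      Q = S • (vecMulVec n n - (1 / 3 : ℝ) • (1 : Matrix (Fin 3) (Fin 3) ℝ))) :
    Xor'
      (Q = (3 * β / 2) •
        (vecMulVec zhat zhat - (1 / 3 : ℝ) • (1 : Matrix (Fin 3) (Fin 3) ℝ)))
      (∃ m : Fin 3 → ℝ, m ⬝ᵥ m = 1 ∧ m ⬝ᵥ zhat = 0 ∧
        Q = (-3 * β) •
          (vecMulVec m m - (1 / 3 : ℝ) • (1 : Matrix (Fin 3) (Fin 3) ℝ))) := by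
  subst hz
  obtain ⟨S, n, hS, hn, rfl⟩ := huni
  have h0 := congrFun heig 0
  have h1 := congrFun heig 1
  have h2 := congrFun heig 2
  simp [mulVec, dotProduct, Fin.sum_univ_three, vecMulVec_apply] at h0 h1 h2
  have hn' : n 0 * n 0 + n 1 * n 1 + n 2 * n 2 = 1 := by
    simpa [dotProduct, Fin.sum_univ_three] using hn
  have hexcl : ∀ m : Fin 3 → ℝ,
      (3 * β / 2) • (vecMulVec ![0, 0, 1] ![0, 0, 1] -
        (1 / 3 : ℝ) • (1 : Matrix (Fin 3) (Fin 3) ℝ)) ≠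
      (-3 * β) • (vecMulVec m m - (1 / 3 : ℝ) • (1 : Matrix (Fin 3) (Fin 3) ℝ)) := by
    intro m h
    have e00 := congrFun (congrFun h 0) 0
    have e11 := congrFun (congrFun h 1) 1
    have e01 := congrFun (congrFun h 0) 1
    simp only [Matrix.smul_apply, Matrix.sub_apply, vecMulVec_apply, one_apply, smul_eq_mul, cons_val,
      Fin.reduceEq, if_true, if_false] at e00 e11 e01
    have f00 : m 0 * m 0 = 1 / 2 := mul_left_cancel₀ hβ (by linarith)
    have f11 : m 1 * m 1 = 1 / 2 := mul_left_cancel₀ hβ (by linarith)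
    have f01 : m 0 * m 1 = 0 := mul_left_cancel₀ hβ (by linarith)
    have : (m 0 * m 0) * (m 1 * m 1) = 0 := by
      linear_combination (m 0 * m 1) * f01
    rw [f00, f11] at this
    norm_num at this
  by_cases hz0 : n 2 = 0
  · have hSβ : S = -3 * β := by
      rw [hz0] at h2
      linarith
    refine Or.inr ⟨⟨n, hn, by simp [dotProduct, Fin.sum_univ_three, hz0], by rw [hSβ]⟩, ?_⟩
    rw [hSβ]
    exact fun h => hexcl n h.symm
  · have hx : n 0 = 0 := by simpa [hS, hz0] using h0
    have hy : n 1 = 0 := by simpa [hS, hz0] using h1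
    have hzz : n 2 * n 2 = 1 := by simpa [hx, hy] using hn'
    have hSβ : S = 3 * β / 2 := by
      rw [hzz] at h2
      linarith
    have hvec : vecMulVec n n = vecMulVec ![0, 0, 1] ![0, 0, 1] := by
      ext i j
      fin_cases i <;> fin_cases j <;> simp [vecMulVec_apply, hx, hy, hzz]
    rw [hSβ, hvec]
    exact Or.inl ⟨rfl, fun ⟨m, _, _, h⟩ => hexcl m h⟩
end
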